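/- arXiv:0904.0407 — 5 statements merged into one kernel-verified Lean document; each statement's English description precedes it below -/
import Mathlib

section
/- For every n ≥ 0, a permutation σ of [n] avoids all three patterns 123, 132 and 213 if and only if σ is a reverse layered matching, i.e., the positions 1,…,n can be split into consecutive blocks, each of size 1 or 2, such that within each block the entries of σ are increasing, and every entry of σ in an earlier block is strictly greater than every entry of σ in any later block. -/
open Finset MvPolynomial

open scoped Classical

/-- `σ` (a permutation of `[n]` in one-line notation `σ 0, …, σ (n-1)`) contains the
pattern `π` (given by its one-line notation as a function `Fin m → Fin m`) if some
subsequence of `σ` is order isomorphic to `π`. -/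
def PermContains {n m : ℕ} (σ : Equiv.Perm (Fin n)) (π : Fin m → Fin m) : Prop :=
  ∃ f : Fin m → Fin n, (∀ a b : Fin m, a < b → f a < f b) ∧
    ∀ a b : Fin m, σ (f a) < σ (f b) ↔ π a < π b

/-- `σ` avoids the pattern `π`. -/
def PermAvoids {n m : ℕ} (σ : Equiv.Perm (Fin n)) (π : Fin m → Fin m) : Prop :=
  ¬ PermContains σ π

/-- The value `σ i` of the one-line notation of `σ`, as a natural number (0-based). -/
def permVal {n : ℕ} (σ : Equiv.Perm (Fin n)) (i : ℕ) : ℕ :=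
  if h : i < n then (σ ⟨i, h⟩ : ℕ) else 0

/-- `inv σ` : the number of inversions, i.e. pairs of positions `i < j` with `σ i > σ j`. -/
def invStat {n : ℕ} (σ : Equiv.Perm (Fin n)) : ℕ :=
  ((Finset.range n ×ˢ Finset.range n).filter
    fun p => p.1 < p.2 ∧ permVal σ p.2 < permVal σ p.1).card

/-- `maj σ` : the sum of all (1-based) indices `i` with `σ(i) > σ(i+1)`; with 0-based
positions, a descent at positions `i, i+1` contributes `i + 1`. -/
def majStat {n : ℕ} (σ : Equiv.Perm (Fin n)) : ℕ :=
  ∑ i ∈ Finset.range (n - 1), if permVal σ (i + 1) < permVal σ i then i + 1 else 0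

/-- The number of ascents of `σ`; for `σ ∈ Sₙ(123,132,213)` (a reverse layered matching)
this equals `d σ`, the number of doubleton blocks. -/
def ascStat {n : ℕ} (σ : Equiv.Perm (Fin n)) : ℕ :=
  ((Finset.range (n - 1)).filter fun i => permVal σ i < permVal σ (i + 1)).card

/-- The number of descents of `σ`; for `σ ∈ Sₙ(231,312,321)` (a layered matching)
this equals `d σ`, the number of doubleton blocks. -/
def descStat {n : ℕ} (σ : Equiv.Perm (Fin n)) : ℕ :=
  ((Finset.range (n - 1)).filter fun i => permVal σ (i + 1) < permVal σ i).card

/-- `Sₙ(123, 132, 213)` : permutations of `[n]` avoiding `123`, `132` and `213`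
(patterns written 0-based). -/
noncomputable def S123 (n : ℕ) : Finset (Equiv.Perm (Fin n)) :=
  Finset.univ.filter fun σ =>
    PermAvoids σ ![0, 1, 2] ∧ PermAvoids σ ![0, 2, 1] ∧ PermAvoids σ ![1, 0, 2]

/-- `Sₙ(231, 312, 321)` : permutations of `[n]` avoiding `231`, `312` and `321`
(patterns written 0-based). -/
noncomputable def S231 (n : ℕ) : Finset (Equiv.Perm (Fin n)) :=
  Finset.univ.filter fun σ =>
    PermAvoids σ ![1, 2, 0] ∧ PermAvoids σ ![2, 0, 1] ∧ PermAvoids σ ![2, 1, 0]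

/-- Given a list `L` of block sizes (splitting positions `0, …, L.sum - 1` into consecutive
blocks), `blockIdx L i` is the index (0-based) of the block containing position `i`. -/
def blockIdx (L : List ℕ) (i : ℕ) : ℕ :=
  ((L.scanl (· + ·) 0).tail).countP fun s => decide (s ≤ i)

/-- `σ` is a reverse layered matching: its positions split into consecutive blocks, each of
size 1 or 2, entries within a block increasing, entries of earlier blocks strictly greater
than entries of later blocks. -/
def IsRevLayeredMatching {n : ℕ} (σ : Equiv.Perm (Fin n)) : Prop :=
  ∃ L : List ℕ, L.sum = n ∧ (∀ b ∈ L, b = 1 ∨ b = 2) ∧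
    (∀ i j : Fin n, blockIdx L (i : ℕ) < blockIdx L (j : ℕ) → σ j < σ i) ∧
    (∀ i j : Fin n, blockIdx L (i : ℕ) = blockIdx L (j : ℕ) → i < j → σ i < σ j)

theorem blockIdx_cons (b : ℕ) (L : List ℕ) (i : ℕ) :
    blockIdx (b :: L) i = if i < b then 0 else blockIdx L (i - b) + 1 := by
  have shift : ∀ (L : List ℕ) (a : ℕ), L.scanl (· + ·) a = (L.scanl (· + ·) 0).map (a + ·) := by
    intro L
    induction L with
    | nil => simp
    | cons c L ih =>
      intro a
      rw [List.scanl_cons, List.scanl_cons, ih (a + c), ih (0 + c)]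
      simp [Function.comp_def, Nat.add_assoc]
  have head : L.scanl (· + ·) 0 = 0 :: (L.scanl (· + ·) 0).tail := by
    cases L <;> simp
  unfold blockIdx
  rw [List.scanl_cons, List.tail_cons, Nat.zero_add, shift L b, List.countP_map]
  split_ifs with h
  · rw [List.countP_eq_zero]
    intro x _
    simp only [Function.comp_apply, decide_eq_true_eq]
    omega
  · rw [head, List.countP_cons, List.tail_cons]
    have hb : b ≤ i := by omega
    simp only [Function.comp_apply, Nat.add_zero, hb, decide_true, if_true]
    congr 1
    apply List.countP_congr
    intro x _
    simp only [Function.comp_apply, decide_eq_true_eq]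
    omega

theorem blockIdx_lt_blockIdx (L : List ℕ) (hL : ∀ b ∈ L, b = 1 ∨ b = 2) (i k : ℕ)
    (hik : i + 2 ≤ k) (hk : k < L.sum) : blockIdx L i < blockIdx L k := by
  induction L generalizing i k with
  | nil => simp at hk
  | cons b L ih =>
    have hb := hL b (by simp)
    rw [List.sum_cons] at hk
    rw [blockIdx_cons, blockIdx_cons, if_neg (by omega : ¬ k < b)]
    split_ifs with h
    · omega
    · have := ih (fun c hc => hL c (by simp [hc])) (i - b) (k - b) (by omega) (by omega)
      omega

/-- A sequence whose entries at distance at least two decrease splits into blocks of size 1 or 2,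
increasing inside the blocks and decreasing from block to block. -/
theorem exists_blocks (n : ℕ) (s : ℕ → ℕ) (hinj : ∀ i < n, ∀ j < n, s i = s j → i = j)
    (hs : ∀ i k, i + 2 ≤ k → k < n → s k < s i) :
    ∃ L : List ℕ, L.sum = n ∧ (∀ b ∈ L, b = 1 ∨ b = 2) ∧
      (∀ i < n, ∀ j < n, blockIdx L i < blockIdx L j → s j < s i) ∧
      (∀ i < n, ∀ j < n, blockIdx L i = blockIdx L j → i < j → s i < s j) := by
  induction n using Nat.strong_induction_on generalizing s with
  | _ n ih =>
    rcases Nat.eq_zero_or_pos n with rfl | hn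
    · exact ⟨[], by simp⟩
    obtain ⟨b, hb, hbn, hdec, hinc⟩ : ∃ b, (b = 1 ∨ b = 2) ∧ b ≤ n ∧
        (∀ i < b, ∀ j, b ≤ j → j < n → s j < s i) ∧
        (∀ i j, i < j → j < b → s i < s j) := by
      by_cases h : 2 ≤ n ∧ s 0 < s 1
      · refine ⟨2, Or.inr rfl, h.1, fun i hi j hj hjn => ?_, fun i j hij hj => ?_⟩
        · have := hs 0 j (by omega) hjn
          interval_cases i <;> omega
        · obtain rfl : i = 0 := by omega
          obtain rfl : j = 1 := by omega
          exact h.2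
      · refine ⟨1, Or.inl rfl, hn, fun i hi j hj hjn => ?_, fun i j hij hj => by omega⟩
        obtain rfl : i = 0 := by omega
        rcases Nat.lt_or_ge 1 j with hj1 | hj1
        · exact hs 0 j (by omega) hjn
        · obtain rfl : j = 1 := by omega
          have := hinj 0 hn 1 hjn
          omega
    obtain ⟨L, hsum, hL, hlt, heq⟩ := ih (n - b) (by omega) (fun i => s (i + b))
      (fun i hi j hj h => by have := hinj (i + b) (by omega) (j + b) (by omega) h; omega)
      (fun i k hik hk => hs (i + b) (k + b) (by omega) (by omega))
    refine ⟨b :: L, by rw [List.sum_cons]; omega, ?_, fun i hi j hj => ?_, fun i hi j hj => ?_⟩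
    · intro c hc
      rcases List.mem_cons.1 hc with rfl | hc
      exacts [hb, hL c hc]
    · rw [blockIdx_cons, blockIdx_cons]
      intro h
      split_ifs at h with h1 h2 h2
      · omega
      · exact hdec i h1 j (by omega) hj
      · omega
      · have := hlt (i - b) (by omega) (j - b) (by omega) (by omega)
        simpa [Nat.sub_add_cancel (not_lt.1 h1), Nat.sub_add_cancel (not_lt.1 h2)] using this
    · rw [blockIdx_cons, blockIdx_cons]
      intro h hij
      split_ifs at h with h1 h2 h2
      · exact hinc i j hij h2
      · have := heq (i - b) (by omega) (j - b) (by omega) (by omega) (by omega)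
        simpa [Nat.sub_add_cancel (not_lt.1 h1), Nat.sub_add_cancel (not_lt.1 h2)] using this

theorem permContains_of_three {n : ℕ} (σ : Equiv.Perm (Fin n)) (π : Fin 3 → Fin 3)
    (i j k : Fin n) (hij : i < j) (hjk : j < k)
    (h : ∀ a b : Fin 3, σ (![i, j, k] a) < σ (![i, j, k] b) ↔ π a < π b) : PermContains σ π := by
  refine ⟨![i, j, k], fun a b hab => ?_, h⟩
  fin_cases a <;> fin_cases b <;> simp_all
  exact hij.trans hjk

theorem permAvoids_iff_decreasing {n : ℕ} (σ : Equiv.Perm (Fin n)) :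
    (PermAvoids σ ![0, 1, 2] ∧ PermAvoids σ ![0, 2, 1] ∧ PermAvoids σ ![1, 0, 2]) ↔
      ∀ i j k : Fin n, i < j → j < k → σ k < σ i := by
  constructor
  · rintro ⟨h123, h132, h213⟩ i j k hij hjk
    by_contra! hik
    have hne : ∀ {a b : Fin n}, a < b → σ a ≠ σ b := fun h h' => h.ne (σ.injective h')
    have hik := lt_of_le_of_ne hik (hne (hij.trans hjk))
    rcases lt_or_gt_of_ne (hne hij) with h1 | h1
    · rcases lt_or_gt_of_ne (hne hjk) with h2 | h2
      · refine h123 (permContains_of_three σ _ i j k hij hjk ?_)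
        simp [Fin.forall_fin_succ, h1, h2, hik, h1.le, h2.le, hik.le]
      · refine h132 (permContains_of_three σ _ i j k hij hjk ?_)
        simp [Fin.forall_fin_succ, h1, h2, hik, h1.le, h2.le, hik.le]
    · have h2 := h1.trans hik
      refine h213 (permContains_of_three σ _ i j k hij hjk ?_)
      simp [Fin.forall_fin_succ, h1, h2, hik, h1.le, h2.le, hik.le]
  · intro h
    have key : ∀ π : Fin 3 → Fin 3, π 0 < π 2 → PermAvoids σ π := by
      rintro π hπ ⟨f, hf, hπf⟩
      exact lt_asymm ((hπf 0 2).2 hπ)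
        (h _ _ _ (hf 0 1 (by decide)) (hf 1 2 (by decide)))
    exact ⟨key _ (by decide), key _ (by decide), key _ (by decide)⟩

/-- A permutation of `[n]` avoids `123`, `132` and `213` iff it is a reverse layered
matching. -/
theorem stmt0 (n : ℕ) (σ : Equiv.Perm (Fin n)) :
    (PermAvoids σ ![0, 1, 2] ∧ PermAvoids σ ![0, 2, 1] ∧ PermAvoids σ ![1, 0, 2]) ↔
      IsRevLayeredMatching σ := by
  rw [permAvoids_iff_decreasing]
  constructor
  · intro h
    have hval : ∀ i (hi : i < n), permVal σ i = σ ⟨i, hi⟩ := fun i hi => dif_pos hi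
    obtain ⟨L, hsum, hL, hlt, heq⟩ := exists_blocks n (permVal σ)
      (fun i hi j hj hij => by
        rw [hval i hi, hval j hj] at hij
        simpa using σ.injective (Fin.ext hij))
      (fun i k hik hk => by
        rw [hval i (by omega), hval k hk]
        exact h ⟨i, by omega⟩ ⟨i + 1, by omega⟩ ⟨k, hk⟩
          (Fin.mk_lt_mk.2 (by omega)) (Fin.mk_lt_mk.2 (by omega)))
    refine ⟨L, hsum, hL, fun i j hij => ?_, fun i j hij hlt' => ?_⟩
    · have := hlt i i.2 j j.2 hij
      rwa [hval i i.2, hval j j.2] at this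
    · have := heq i i.2 j j.2 hij hlt'
      rwa [hval i i.2, hval j j.2] at this
  · rintro ⟨L, hsum, hL, hlt, -⟩ i j k hij hjk
    refine hlt i k (blockIdx_lt_blockIdx L hL i k ?_ ?_)
    · have := Fin.lt_def.1 hij
      have := Fin.lt_def.1 hjk
      omega
    · rw [hsum]
      exact k.2
end

section
/- F_0^I(x,y,q) = 1, F_1^I(x,y,q) = x, and for all n ≥ 2, F_n^I(x,y,q) = x·q^{n−1}·F_{n−1}^I(x,y,q) + y·q^{2(n−2)}·F_{n−2}^I(x,y,q), as an identity in the polynomial ring ℤ[x,y,q]. -/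
open Finset MvPolynomial

open scoped Classical

/-- `Fₙᴵ(x, y, q) = Σ_{σ ∈ Sₙ(123,132,213)} x^(s σ) * y^(d σ) * q^(inv σ)` in `ℤ[x,y,q]`,
where `d σ = ascStat σ` is the number of doubletons and `s σ = n - 2 * d σ` the number of
singletons; here `x = X 0`, `y = X 1`, `q = X 2`. -/
noncomputable def FI (n : ℕ) : MvPolynomial (Fin 3) ℤ :=
  ∑ σ ∈ S123 n, X 0 ^ (n - 2 * ascStat σ) * X 1 ^ ascStat σ * X 2 ^ invStat σ

lemma permVal_of_lt {n : ℕ} (σ : Equiv.Perm (Fin n)) {i : ℕ} (h : i < n) :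
    permVal σ i = (σ ⟨i, h⟩ : ℕ) := by
  simp [permVal, h]

lemma permVal_lt {n : ℕ} (σ : Equiv.Perm (Fin n)) {i : ℕ} (h : i < n) : permVal σ i < n := by
  rw [permVal_of_lt σ h]
  exact Fin.is_lt _

lemma permVal_injOn {n : ℕ} (σ : Equiv.Perm (Fin n)) {i j : ℕ} (hi : i < n) (hj : j < n)
    (h : permVal σ i = permVal σ j) : i = j := by
  rw [permVal_of_lt σ hi, permVal_of_lt σ hj] at h
  simpa using σ.injective (Fin.ext h)

lemma exists_permVal_eq {n : ℕ} (σ : Equiv.Perm (Fin n)) {v : ℕ} (hv : v < n) :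
    ∃ i < n, permVal σ i = v :=
  ⟨σ.symm ⟨v, hv⟩, Fin.is_lt _, by rw [permVal_of_lt σ (Fin.is_lt _)]; simp⟩

lemma perm_ext_permVal {n : ℕ} {σ τ : Equiv.Perm (Fin n)}
    (h : ∀ i < n, permVal σ i = permVal τ i) : σ = τ := by
  ext i
  simpa [permVal_of_lt _ i.is_lt] using h i i.is_lt

lemma permContains_three {n : ℕ} {σ : Equiv.Perm (Fin n)} {π : Fin 3 → Fin 3} {i j k : Fin n}
    (hij : i < j) (hjk : j < k) (h01 : σ i < σ j ↔ π 0 < π 1) (h02 : σ i < σ k ↔ π 0 < π 2)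
    (h12 : σ j < σ k ↔ π 1 < π 2) (h10 : σ j < σ i ↔ π 1 < π 0) (h20 : σ k < σ i ↔ π 2 < π 0)
    (h21 : σ k < σ j ↔ π 2 < π 1) : PermContains σ π := by
  refine ⟨![i, j, k], ?_, ?_⟩
  · intro a b hab
    fin_cases a <;> fin_cases b <;> simp_all [hij.trans hjk]
  · intro a b
    fin_cases a <;> fin_cases b <;> simp_all

/-- Avoiding `123`, `132` and `213` means that entries at distance at least two are inverted. -/
lemma mem_S123_iff {n : ℕ} {σ : Equiv.Perm (Fin n)} :
    σ ∈ S123 n ↔ ∀ i k : ℕ, i + 2 ≤ k → k < n → permVal σ k < permVal σ i := by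
  rw [S123, Finset.mem_filter]
  simp only [Finset.mem_univ, true_and, PermAvoids]
  constructor
  · rintro ⟨h1, h2, h3⟩ i k hik hk
    rw [permVal_of_lt σ hk, permVal_of_lt σ (by omega : i < n), Fin.val_fin_lt]
    by_contra! hle
    have hij : (⟨i, by omega⟩ : Fin n) < ⟨i + 1, by omega⟩ := by simp
    have hjk : (⟨i + 1, by omega⟩ : Fin n) < ⟨k, hk⟩ := by simp; omega
    have nik := σ.injective.ne (hij.trans hjk).ne
    have nij := σ.injective.ne hij.ne
    have njk := σ.injective.ne hjk.ne
    have lik := lt_of_le_of_ne hle nik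
    rcases lt_or_gt_of_ne nij with a | a
    · rcases lt_or_gt_of_ne njk with b | b
      · exact h1 (permContains_three hij hjk (by simp [a]) (by simp [lik]) (by simp [b])
          (by simp [a.le]) (by simp [lik.le]) (by simp [b.le]))
      · exact h2 (permContains_three hij hjk (by simp [a]) (by simp [lik]) (by simp [b.le])
          (by simp [a.le]) (by simp [lik.le]) (by simp [b]))
    · have b := a.trans lik
      exact h3 (permContains_three hij hjk (by simp [a.le]) (by simp [lik]) (by simp [b])
        (by simp [a]) (by simp [lik.le]) (by simp [b.le]))
  · intro h
    have key (π : Fin 3 → Fin 3) (hπ : π 0 < π 2) : ¬ PermContains σ π := by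
      rintro ⟨f, hf, hσ⟩
      have h01 : (f 0 : ℕ) < f 1 := hf 0 1 (by decide)
      have h12 : (f 1 : ℕ) < f 2 := hf 1 2 (by decide)
      have h20 := h (f 0) (f 2) (by omega) (f 2).is_lt
      rw [permVal_of_lt σ (f 2).is_lt, permVal_of_lt σ (f 0).is_lt, Fin.val_fin_lt] at h20
      exact lt_asymm h20 ((hσ 0 2).2 hπ)
    exact ⟨key _ (by decide), key _ (by decide), key _ (by decide)⟩

/-- The permutation of `[n + k]` with one-line notation `n, n + 1, …, n + k - 1` followed by
that of `τ`. -/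
def prependTop (k : ℕ) {n : ℕ} (τ : Equiv.Perm (Fin n)) : Equiv.Perm (Fin (n + k)) :=
  (finCongr (Nat.add_comm n k)).trans <| finSumFinEquiv.symm.trans <|
    ((Equiv.sumComm _ _).trans (Equiv.sumCongr τ (Equiv.refl _))).trans finSumFinEquiv

lemma permVal_prependTop_of_lt {k n : ℕ} (τ : Equiv.Perm (Fin n)) {i : ℕ} (hi : i < k) :
    permVal (prependTop k τ) i = n + i := by
  have h : (finCongr (Nat.add_comm n k)) ⟨i, by omega⟩ = Fin.castAdd n ⟨i, hi⟩ := by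
    ext; simp
  rw [permVal_of_lt _ (by omega)]
  rw [prependTop, Equiv.trans_apply, h, Equiv.trans_apply, finSumFinEquiv_symm_apply_castAdd]
  simp

lemma permVal_prependTop_add {k n : ℕ} (τ : Equiv.Perm (Fin n)) (i : ℕ) :
    permVal (prependTop k τ) (k + i) = permVal τ i := by
  by_cases hi : i < n
  · have h : (finCongr (Nat.add_comm n k)) ⟨k + i, by omega⟩ = Fin.natAdd k ⟨i, hi⟩ := by
      ext; simp
    rw [permVal_of_lt _ (by omega), permVal_of_lt _ hi]
    rw [prependTop, Equiv.trans_apply, h, Equiv.trans_apply, finSumFinEquiv_symm_apply_natAdd]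
    simp
  · simp [permVal, hi, show ¬ k + i < n + k by omega]

lemma prependTop_injective (k n : ℕ) :
    Function.Injective (prependTop k : Equiv.Perm (Fin n) → Equiv.Perm (Fin (n + k))) := by
  intro σ τ h
  refine perm_ext_permVal fun i _ => ?_
  rw [← permVal_prependTop_add (k := k) σ, ← permVal_prependTop_add (k := k) τ, h]

lemma exists_prependTop_eq {k n : ℕ} {σ : Equiv.Perm (Fin (n + k))}
    (h : ∀ i < k, permVal σ i = n + i) : ∃ τ : Equiv.Perm (Fin n), prependTop k τ = σ := by
  have hlt (j : ℕ) (hj : j < n) : permVal σ (k + j) < n := by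
    by_contra! hle
    have h1 := permVal_lt σ (show k + j < n + k by omega)
    have h2 := h (permVal σ (k + j) - n) (by omega)
    have h3 := permVal_injOn σ (i := permVal σ (k + j) - n) (j := k + j) (by omega) (by omega)
      (by omega)
    omega
  have hinj : Function.Injective fun j : Fin n => (⟨permVal σ (k + j), hlt j j.is_lt⟩ : Fin n) := by
    intro a b hab
    have := permVal_injOn σ (by omega) (by omega) (Fin.mk.inj_iff.1 hab)
    exact Fin.ext (by omega)
  refine ⟨Equiv.ofBijective _ (Finite.injective_iff_bijective.1 hinj), perm_ext_permVal ?_⟩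
  intro i hi
  rcases lt_or_ge i k with hik | hik
  · rw [permVal_prependTop_of_lt _ hik, h i hik]
  · obtain ⟨j, rfl⟩ := Nat.exists_eq_add_of_le hik
    rw [permVal_prependTop_add, permVal_of_lt _ (by omega : j < n)]
    rfl

lemma prependTop_mem_S123 {k n : ℕ} (hk : k ≤ 2) {τ : Equiv.Perm (Fin n)} :
    prependTop k τ ∈ S123 (n + k) ↔ τ ∈ S123 n := by
  rw [mem_S123_iff, mem_S123_iff]
  constructor
  · intro h i j hij hj
    simpa only [permVal_prependTop_add] using h (k + i) (k + j) (by omega) (by omega)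
  · intro h i j hij hj
    obtain ⟨j, rfl⟩ := Nat.exists_eq_add_of_le (show k ≤ j by omega)
    have h1 := permVal_lt τ (show j < n by omega)
    rw [permVal_prependTop_add]
    rcases lt_or_ge i k with hik | hik
    · rw [permVal_prependTop_of_lt _ hik]
      omega
    · obtain ⟨i, rfl⟩ := Nat.exists_eq_add_of_le hik
      rw [permVal_prependTop_add]
      exact h i j (by omega) (by omega)

lemma invStat_eq_sum {n : ℕ} (σ : Equiv.Perm (Fin n)) :
    invStat σ = ∑ i ∈ range n, ∑ j ∈ range n,
      if i < j ∧ permVal σ j < permVal σ i then 1 else 0 := by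
  rw [invStat, Finset.card_filter, Finset.sum_product]

lemma ascStat_eq_sum {n : ℕ} (σ : Equiv.Perm (Fin n)) :
    ascStat σ = ∑ i ∈ range (n - 1), if permVal σ i < permVal σ (i + 1) then 1 else 0 := by
  rw [ascStat, Finset.card_filter]

lemma invStat_prependTop (k : ℕ) {n : ℕ} (τ : Equiv.Perm (Fin n)) :
    invStat (prependTop k τ) = k * n + invStat τ := by
  have h1 : ∀ i ∈ range k, (∑ j ∈ range (k + n),
      if i < j ∧ permVal (prependTop k τ) j < permVal (prependTop k τ) i then 1 else 0) = n := by
    intro i hi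
    rw [Finset.mem_range] at hi
    rw [Finset.sum_range_add, Finset.sum_eq_zero, Finset.sum_congr rfl (g := fun _ => 1)]
    · simp
    · intro j hj
      have := permVal_lt τ (Finset.mem_range.1 hj)
      rw [permVal_prependTop_add, permVal_prependTop_of_lt _ hi, if_pos (by omega)]
    · intro j hj
      rw [permVal_prependTop_of_lt _ hi, permVal_prependTop_of_lt _ (Finset.mem_range.1 hj),
        if_neg (by omega)]
  have h2 : ∀ i ∈ range n, (∑ j ∈ range (k + n),
      if k + i < j ∧ permVal (prependTop k τ) j < permVal (prependTop k τ) (k + i)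
        then 1 else 0) =
      ∑ j ∈ range n, if i < j ∧ permVal τ j < permVal τ i then 1 else 0 := by
    intro i hi
    rw [Finset.sum_range_add, Finset.sum_eq_zero, zero_add]
    · simp only [permVal_prependTop_add, add_lt_add_iff_left]
    · intro j hj
      rw [Finset.mem_range] at hj
      rw [if_neg (by omega)]
  have hr : range (n + k) = range (k + n) := by rw [Nat.add_comm]
  rw [invStat_eq_sum, invStat_eq_sum, hr, Finset.sum_range_add,
    Finset.sum_congr rfl h1, Finset.sum_congr rfl h2]
  simp

lemma ascStat_prependTop (k : ℕ) {n : ℕ} (τ : Equiv.Perm (Fin n)) :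
    ascStat (prependTop (k + 1) τ) = k + ascStat τ := by
  have h1 : (∑ i ∈ range k, if permVal (prependTop (k + 1) τ) i <
      permVal (prependTop (k + 1) τ) (i + 1) then 1 else 0) = k := by
    rw [Finset.sum_congr rfl (g := fun _ => 1)]
    · simp
    · intro i hi
      rw [Finset.mem_range] at hi
      rw [permVal_prependTop_of_lt _ (by omega), permVal_prependTop_of_lt _ (by omega),
        if_pos (by omega)]
  rw [ascStat_eq_sum, ascStat_eq_sum]
  obtain _ | n := n
  · simpa using h1
  · have h0 := permVal_lt τ (Nat.succ_pos n)
    have h2 := permVal_prependTop_add (k := k + 1) τ 0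
    rw [add_zero] at h2
    rw [show n + 1 + (k + 1) - 1 = k + 1 + n by omega, Finset.sum_range_add,
      Finset.sum_range_succ, h1, permVal_prependTop_of_lt _ (Nat.lt_succ_self k), h2,
      if_neg (by omega)]
    simp only [permVal_prependTop_add, add_assoc (k + 1), add_zero, Nat.add_sub_cancel]

lemma exists_prependTop_of_mem_S123 {n : ℕ} {σ : Equiv.Perm (Fin (n + 2))}
    (hσ : σ ∈ S123 (n + 2)) :
    (∃ τ ∈ S123 (n + 1), prependTop 1 τ = σ) ∨ ∃ τ ∈ S123 n, prependTop 2 τ = σ := by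
  have h := mem_S123_iff.1 hσ
  obtain ⟨p, hp, hpv⟩ := exists_permVal_eq σ (show n + 1 < n + 2 by omega)
  have hp2 : p < 2 := by
    by_contra! hle
    have h1 := h 0 p (by omega) hp
    have h2 := permVal_lt σ (show 0 < n + 2 by omega)
    omega
  obtain rfl | rfl : p = 0 ∨ p = 1 := by omega
  · left
    obtain ⟨τ, rfl⟩ := exists_prependTop_eq (n := n + 1) (k := 1) (σ := σ) (by
      intro i hi
      obtain rfl : i = 0 := by omega
      exact hpv)
    exact ⟨τ, (prependTop_mem_S123 one_le_two).1 hσ, rfl⟩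
  · right
    obtain ⟨r, hr, hrv⟩ := exists_permVal_eq σ (show n < n + 2 by omega)
    have hr0 : r = 0 := by
      by_contra hne
      have hr1 : r ≠ 1 := by
        rintro rfl
        omega
      have h1 := h 0 r (by omega) hr
      have h2 := permVal_lt σ (show 0 < n + 2 by omega)
      have h3 := permVal_injOn σ (i := 0) (j := 1) (by omega) (by omega) (by omega)
      omega
    subst hr0
    obtain ⟨τ, rfl⟩ := exists_prependTop_eq (n := n) (k := 2) (σ := σ) (by
      intro i hi
      obtain rfl | rfl : i = 0 ∨ i = 1 := by omega
      · exact hrv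
      · exact hpv)
    exact ⟨τ, (prependTop_mem_S123 le_rfl).1 hσ, rfl⟩

lemma S123_add_two (n : ℕ) :
    S123 (n + 2) = (S123 (n + 1)).image (prependTop 1) ∪ (S123 n).image (prependTop 2) := by
  ext σ
  simp only [Finset.mem_union, Finset.mem_image]
  refine ⟨exists_prependTop_of_mem_S123, ?_⟩
  rintro (⟨τ, hτ, rfl⟩ | ⟨τ, hτ, rfl⟩)
  · exact (prependTop_mem_S123 one_le_two).2 hτ
  · exact (prependTop_mem_S123 le_rfl).2 hτ

lemma disjoint_image_prependTop (n : ℕ) :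
    Disjoint ((S123 (n + 1)).image (prependTop 1)) ((S123 n).image (prependTop 2)) := by
  rw [Finset.disjoint_left]
  intro σ h1 h2
  obtain ⟨τ, -, rfl⟩ := Finset.mem_image.1 h1
  obtain ⟨ρ, -, h⟩ := Finset.mem_image.1 h2
  have hτ := permVal_prependTop_of_lt τ (show 0 < 1 by omega)
  have hρ := permVal_prependTop_of_lt ρ (show 0 < 2 by omega)
  have h0 := congrArg (fun σ : Equiv.Perm (Fin (n + 2)) => permVal σ 0) h
  omega

lemma two_mul_ascStat_le {n : ℕ} {σ : Equiv.Perm (Fin n)} (hσ : σ ∈ S123 n) :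
    2 * ascStat σ ≤ n := by
  induction n using Nat.strong_induction_on with
  | _ n ih =>
    match n with
    | 0 => simp [ascStat]
    | 1 => simp [ascStat]
    | n + 2 =>
      obtain ⟨τ, hτ, rfl⟩ | ⟨τ, hτ, rfl⟩ := exists_prependTop_of_mem_S123 hσ
      · have := ih (n + 1) (by omega) hτ
        have : ascStat (prependTop 1 τ) = 0 + ascStat τ := ascStat_prependTop 0 τ
        omega
      · have := ih n (by omega) hτ
        have : ascStat (prependTop 2 τ) = 1 + ascStat τ := ascStat_prependTop 1 τ
        omega

lemma FI_add_two (n : ℕ) :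
    FI (n + 2) = X 0 * X 2 ^ (n + 1) * FI (n + 1) + X 1 * X 2 ^ (2 * n) * FI n := by
  have h1 (τ : Equiv.Perm (Fin (n + 1))) (hτ : τ ∈ S123 (n + 1)) :
      (X 0 ^ (n + 2 - 2 * ascStat (prependTop 1 τ)) * X 1 ^ ascStat (prependTop 1 τ) *
        X 2 ^ invStat (prependTop 1 τ) : MvPolynomial (Fin 3) ℤ) =
      X 0 * X 2 ^ (n + 1) *
        (X 0 ^ (n + 1 - 2 * ascStat τ) * X 1 ^ ascStat τ * X 2 ^ invStat τ) := by
    have hle := two_mul_ascStat_le hτ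
    have hasc : ascStat (prependTop 1 τ) = 0 + ascStat τ := ascStat_prependTop 0 τ
    rw [hasc, invStat_prependTop,
      show n + 2 - 2 * (0 + ascStat τ) = n + 1 - 2 * ascStat τ + 1 by omega]
    ring
  have h2 (τ : Equiv.Perm (Fin n)) :
      (X 0 ^ (n + 2 - 2 * ascStat (prependTop 2 τ)) * X 1 ^ ascStat (prependTop 2 τ) *
        X 2 ^ invStat (prependTop 2 τ) : MvPolynomial (Fin 3) ℤ) =
      X 1 * X 2 ^ (2 * n) *
        (X 0 ^ (n - 2 * ascStat τ) * X 1 ^ ascStat τ * X 2 ^ invStat τ) := by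
    have hasc : ascStat (prependTop 2 τ) = 1 + ascStat τ := ascStat_prependTop 1 τ
    rw [hasc, invStat_prependTop,
      show n + 2 - 2 * (1 + ascStat τ) = n - 2 * ascStat τ by omega]
    ring
  rw [FI, S123_add_two, Finset.sum_union (disjoint_image_prependTop n),
    Finset.sum_image (prependTop_injective 1 (n + 1)).injOn,
    Finset.sum_image (prependTop_injective 2 n).injOn, FI, FI, Finset.mul_sum, Finset.mul_sum]
  exact congrArg₂ (· + ·) (Finset.sum_congr rfl h1) (Finset.sum_congr rfl fun τ _ => h2 τ)

lemma S123_eq_univ {n : ℕ} (hn : n ≤ 2) : S123 n = Finset.univ :=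
  Finset.eq_univ_of_forall fun _ => mem_S123_iff.2 fun _ _ _ _ => by omega

/-- `F₀ᴵ = 1`, `F₁ᴵ = x`, and for `n ≥ 2`,
`Fₙᴵ = x q^(n-1) F_{n-1}ᴵ + y q^(2(n-2)) F_{n-2}ᴵ` in `ℤ[x,y,q]`. -/
theorem stmt2 :
    FI 0 = 1 ∧ FI 1 = X 0 ∧
      ∀ n : ℕ, 2 ≤ n →
        FI n = X 0 * X 2 ^ (n - 1) * FI (n - 1) + X 1 * X 2 ^ (2 * (n - 2)) * FI (n - 2) := by
  refine ⟨?_, ?_, ?_⟩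
  · simp [FI, S123_eq_univ, ascStat, invStat]
  · simp [FI, S123_eq_univ, ascStat, invStat, Finset.filter_singleton]
  · intro n hn
    obtain ⟨m, rfl⟩ := Nat.exists_eq_add_of_le' hn
    exact FI_add_two m
end

section
/- For every n ≥ 0, Σ_{σ ∈ S_n(123,132,213)} x^{s(σ)} y^{d(σ)} q^{maj(σ)} = Σ_{τ ∈ S_n(231,312,321)} x^{s(τ)} y^{d(τ)} q^{C(n,2) − maj(τ)}, as an identity in ℤ[x,y,q]; that is, F_n^M(x,y,q) = q^{C(n,2)} F_n^{M'}(x,y,1/q), where C(n,2) = n(n−1)/2 and maj(τ) ≤ C(n,2) for all τ. -/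
open Finset MvPolynomial

open scoped Classical

/-- The complement of `σ`, sending `i` to `n - 1 - σ i`. -/
def permCompl {n : ℕ} : Equiv.Perm (Fin n) ≃ Equiv.Perm (Fin n) :=
  Equiv.mulLeft Fin.revPerm

theorem permCompl_apply {n : ℕ} (σ : Equiv.Perm (Fin n)) (i : Fin n) :
    permCompl σ i = (σ i).rev := rfl

theorem permContains_permCompl {n m : ℕ} (σ : Equiv.Perm (Fin n)) {π ρ : Fin m → Fin m}
    (h : ∀ a b, π a < π b ↔ ρ b < ρ a) :
    PermContains (permCompl σ) π ↔ PermContains σ ρ := by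
  refine exists_congr fun f => and_congr_right fun _ => ?_
  simp only [permCompl_apply, Fin.rev_lt_rev, h]
  exact forall_comm

theorem permCompl_mem_S231 {n : ℕ} (σ : Equiv.Perm (Fin n)) :
    permCompl σ ∈ S231 n ↔ σ ∈ S123 n := by
  simp only [S231, S123, mem_filter, mem_univ, true_and]
  unfold PermAvoids
  rw [permContains_permCompl σ (π := ![1, 2, 0]) (ρ := ![1, 0, 2]) (by decide),
    permContains_permCompl σ (π := ![2, 0, 1]) (ρ := ![0, 2, 1]) (by decide),
    permContains_permCompl σ (π := ![2, 1, 0]) (ρ := ![0, 1, 2]) (by decide)]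
  tauto

theorem permVal_permCompl_lt {n : ℕ} (σ : Equiv.Perm (Fin n)) {i j : ℕ} (hi : i < n)
    (hj : j < n) :
    permVal (permCompl σ) i < permVal (permCompl σ) j ↔ permVal σ j < permVal σ i := by
  simp only [permVal, hi, hj, dif_pos, permCompl_apply, ← Fin.lt_def, Fin.rev_lt_rev]

theorem permVal_ne_succ {n : ℕ} (σ : Equiv.Perm (Fin n)) {i : ℕ} (hi : i + 1 < n) :
    permVal σ i ≠ permVal σ (i + 1) := by
  simp only [permVal, hi, Nat.lt_of_succ_lt hi, dif_pos]
  intro h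
  simpa using σ.injective (Fin.ext h)

theorem descStat_permCompl {n : ℕ} (σ : Equiv.Perm (Fin n)) :
    descStat (permCompl σ) = ascStat σ := by
  unfold descStat ascStat
  congr 1
  refine filter_congr fun i hi => ?_
  rw [mem_range] at hi
  exact permVal_permCompl_lt σ (by omega) (by omega)

theorem sum_range_pred_succ (n : ℕ) : ∑ i ∈ range (n - 1), (i + 1) = n.choose 2 := by
  cases n with
  | zero => rfl
  | succ n =>
    have h := sum_range_succ' (fun i => i) n
    rw [sum_range_id, ← Nat.choose_two_right] at h
    simpa using h.symm

theorem majStat_le {n : ℕ} (σ : Equiv.Perm (Fin n)) : majStat σ ≤ n.choose 2 := by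
  rw [← sum_range_pred_succ]
  refine sum_le_sum fun i _ => ?_
  split_ifs <;> omega

theorem majStat_add_majStat_permCompl {n : ℕ} (σ : Equiv.Perm (Fin n)) :
    majStat σ + majStat (permCompl σ) = n.choose 2 := by
  rw [← sum_range_pred_succ, majStat, majStat, ← sum_add_distrib]
  refine sum_congr rfl fun i hi => ?_
  rw [mem_range] at hi
  have hne := permVal_ne_succ σ (i := i) (by omega)
  simp only [permVal_permCompl_lt σ (i := i + 1) (j := i) (by omega) (by omega)]
  split_ifs <;> omega

/-- For all `n`, `maj τ ≤ C(n,2)` for every `τ ∈ Sₙ(231,312,321)`, and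
`Σ_{σ ∈ Sₙ(123,132,213)} x^(s σ) y^(d σ) q^(maj σ)
  = Σ_{τ ∈ Sₙ(231,312,321)} x^(s τ) y^(d τ) q^(C(n,2) - maj τ)` in `ℤ[x,y,q]`,
i.e. `Fₙᴹ(x,y,q) = q^C(n,2) Fₙᴹ'(x,y,1/q)`. -/
theorem stmt5 (n : ℕ) :
    (∀ τ ∈ S231 n, majStat τ ≤ n.choose 2) ∧
      ((∑ σ ∈ S123 n, X 0 ^ (n - 2 * ascStat σ) * X 1 ^ ascStat σ * X 2 ^ majStat σ :
            MvPolynomial (Fin 3) ℤ))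
        = ∑ τ ∈ S231 n,
            X 0 ^ (n - 2 * descStat τ) * X 1 ^ descStat τ * X 2 ^ (n.choose 2 - majStat τ) := by
  refine ⟨fun τ _ => majStat_le τ, sum_equiv permCompl
    (fun σ => (permCompl_mem_S231 σ).symm) fun σ _ => ?_⟩
  rw [descStat_permCompl, ← majStat_add_majStat_permCompl σ, Nat.add_sub_cancel]
end

section
/- For every n ≥ 0, Σ_{τ ∈ S_n(231,312,321)} x^{s(τ)} y^{d(τ)} q^{maj(τ)} = Σ_{μ ∈ MS_n} x^{t(μ)} y^{h(μ)} q^{w(μ)}, as an identity in ℤ[x,y,q]; moreover the bijection φ : MS_n → S_n(231,312,321) sending the i-th letter of μ to the i-th block of a layered matching (dot ↦ singleton, dash ↦ doubleton) satisfies w(μ) = maj(φ(μ)) for every μ ∈ MS_n. -/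
open Finset MvPolynomial

open scoped Classical

/-- The length of a Morse sequence (`false` = dot, of length 1; `true` = dash, of
length 2). -/
def mLen (μ : List Bool) : ℕ := (μ.map fun b => if b then 2 else 1).sum

/-- Auxiliary weight: `morseWAux a μ` is the Cigler weight of `μ` given that a prefix of
total length `a` precedes it: each dash contributes (length of the part of the sequence
before it) + 1, dots contribute 0. -/
def morseWAux : ℕ → List Bool → ℕ
  | _, [] => 0
  | a, false :: t => morseWAux (a + 1) t
  | a, true :: t => (a + 1) + morseWAux (a + 2) t

/-- Cigler's weight `w μ` of a Morse sequence: the sum over all dashes of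
(length of the portion of the sequence before the dash) + 1. -/
def morseW (μ : List Bool) : ℕ := morseWAux 0 μ

/-- `MSₙ`, the set of Morse sequences of length `n`. -/
def MSn (n : ℕ) : Finset (List Bool) :=
  (((Finset.range (n + 1)).biUnion fun k =>
      (Finset.univ : Finset (Fin k → Bool)).image List.ofFn)).filter
    fun μ => mLen μ = n

lemma mLen_nil : mLen [] = 0 := rfl

lemma mLen_false_cons (t : List Bool) : mLen (false :: t) = 1 + mLen t := by
  simp [mLen]

lemma mLen_true_cons (t : List Bool) : mLen (true :: t) = 2 + mLen t := by
  simp [mLen]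

lemma length_le_mLen (μ : List Bool) : μ.length ≤ mLen μ := by
  induction μ with
  | nil => simp
  | cons b t ih =>
    cases b <;> simp only [mLen_false_cons, mLen_true_cons, List.length_cons] <;> omega

lemma mLen_eq_count (μ : List Bool) : mLen μ = μ.count false + 2 * μ.count true := by
  induction μ with
  | nil => simp [mLen]
  | cons b t ih =>
    cases b <;> simp [mLen_false_cons, mLen_true_cons, ih] <;> omega

lemma mem_MSn {n : ℕ} {μ : List Bool} : μ ∈ MSn n ↔ mLen μ = n := by
  simp only [MSn, mem_filter, mem_biUnion, mem_range, mem_image, mem_univ, true_and,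
    and_iff_right_iff_imp]
  intro h
  exact ⟨μ.length, by have := length_le_mLen μ; omega, μ.get, List.ofFn_get μ⟩

/-- The layered matching on `ℕ` whose blocks, starting at position `a`, are described by the
letters of a Morse sequence; it is the identity outside of these blocks. -/
def morseFun : ℕ → List Bool → ℕ → ℕ
  | _, [], i => i
  | a, false :: t, i => morseFun (a + 1) t i
  | a, true :: t, i => if i = a then a + 1 else if i = a + 1 then a else morseFun (a + 2) t i

lemma morseFun_of_lt {a : ℕ} {μ : List Bool} {i : ℕ} (h : i < a) : morseFun a μ i = i := by
  induction μ generalizing a with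
  | nil => rfl
  | cons b t ih =>
    cases b
    · exact ih (by omega)
    · simp only [morseFun]
      rw [if_neg (by omega), if_neg (by omega), ih (by omega)]

lemma morseFun_of_ge {a : ℕ} {μ : List Bool} {i : ℕ} (h : a + mLen μ ≤ i) :
    morseFun a μ i = i := by
  induction μ generalizing a with
  | nil => rfl
  | cons b t ih =>
    cases b
    · rw [mLen_false_cons] at h
      exact ih (by omega)
    · rw [mLen_true_cons] at h
      simp only [morseFun]
      rw [if_neg (by omega), if_neg (by omega), ih (by omega)]

lemma morseFun_near (a : ℕ) (μ : List Bool) (i : ℕ) :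
    morseFun a μ i ≤ i + 1 ∧ i ≤ morseFun a μ i + 1 := by
  induction μ generalizing a with
  | nil => simp [morseFun]
  | cons b t ih =>
    cases b
    · exact ih _
    · simp only [morseFun]
      have := ih (a + 2)
      split_ifs <;> omega

lemma le_morseFun {a : ℕ} {μ : List Bool} {i : ℕ} (h : a ≤ i) : a ≤ morseFun a μ i := by
  induction μ generalizing a with
  | nil => exact h
  | cons b t ih =>
    cases b
    · simp only [morseFun]
      rcases h.eq_or_lt with rfl | h
      · rw [morseFun_of_lt (by omega)]
      · have := ih (a := a + 1) (by omega)
        omega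
    · simp only [morseFun]
      split_ifs
      · omega
      · omega
      · have := ih (a := a + 2) (by omega)
        omega

lemma morseFun_involutive (a : ℕ) (μ : List Bool) : Function.Involutive (morseFun a μ) := by
  induction μ generalizing a with
  | nil => intro i; rfl
  | cons b t ih =>
    cases b
    · exact ih _
    · intro i
      by_cases h₁ : i = a
      · simp [morseFun, h₁]
      by_cases h₂ : i = a + 1
      · simp [morseFun, h₂]
      have key : morseFun (a + 2) t i ≠ a ∧ morseFun (a + 2) t i ≠ a + 1 := by
        rcases lt_or_ge i (a + 2) with h | h
        · rw [morseFun_of_lt h]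
          exact ⟨h₁, h₂⟩
        · have := le_morseFun (μ := t) h
          omega
      simp only [morseFun, if_neg h₁, if_neg h₂, if_neg key.1, if_neg key.2]
      exact ih _ i

lemma morseFun_lt {a : ℕ} {μ : List Bool} {i : ℕ} (h : i < a + mLen μ) :
    morseFun a μ i < a + mLen μ := by
  by_contra! hge
  have := morseFun_of_ge hge
  rw [morseFun_involutive] at this
  omega

lemma morseFun_injective {a : ℕ} {μ ν : List Bool} (hlen : mLen μ = mLen ν)
    (h : ∀ i, morseFun a μ i = morseFun a ν i) : μ = ν := by
  induction μ generalizing a ν with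
  | nil =>
    have := length_le_mLen ν
    rw [← hlen, mLen_nil] at this
    exact (List.length_eq_zero_iff.mp (by omega)).symm
  | cons b t ih =>
    cases ν with
    | nil =>
      have := length_le_mLen (b :: t)
      rw [hlen, mLen_nil] at this
      simp at this
    | cons c s =>
      have ha := h a
      cases b <;> cases c <;> simp only [mLen_false_cons, mLen_true_cons] at hlen <;>
        simp only [morseFun, if_true] at ha h
      · rw [ih (by omega) h]
      · rw [morseFun_of_lt (by omega)] at ha
        omega
      · rw [morseFun_of_lt (μ := s) (by omega)] at ha
        omega
      · rw [ih (a := a + 2) (ν := s) (by omega)]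
        intro i
        rcases lt_or_ge i (a + 2) with hi | hi
        · rw [morseFun_of_lt hi, morseFun_of_lt hi]
        · have := h i
          rwa [if_neg (by omega), if_neg (by omega), if_neg (by omega), if_neg (by omega)] at this

/-- Summing `g` over the descents of `morseFun a μ` amounts to summing `g` over the starting
positions of the dashes of `μ`. -/
lemma sum_descents_morseFun (g : ℕ → ℕ) (W : ℕ → List Bool → ℕ) (hnil : ∀ a, W a [] = 0)
    (hdot : ∀ a t, W a (false :: t) = W (a + 1) t)
    (hdash : ∀ a t, W a (true :: t) = g a + W (a + 2) t) (a : ℕ) (μ : List Bool) :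
    (∑ i ∈ Ico a (a + mLen μ), if morseFun a μ (i + 1) < morseFun a μ i then g i else 0)
      = W a μ := by
  induction μ generalizing a with
  | nil => simp [mLen_nil, hnil]
  | cons b t ih =>
    cases b
    · rw [mLen_false_cons, hdot, ← ih, sum_eq_sum_Ico_succ_bot (by omega), if_neg]
      · rw [zero_add, ← add_assoc]
        rfl
      · have := le_morseFun (μ := t) (le_refl (a + 1))
        simp only [morseFun]
        rw [morseFun_of_lt (Nat.lt_succ_self a)]
        omega
    · rw [mLen_true_cons, hdash, ← ih, sum_eq_sum_Ico_succ_bot (by omega),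
        sum_eq_sum_Ico_succ_bot (by omega), if_pos (by simp [morseFun]), if_neg, zero_add,
        ← add_assoc a 2]
      · congr 1
        refine sum_congr rfl fun i hi => ?_
        have := (mem_Ico.mp hi).1
        rw [show morseFun a (true :: t) i = morseFun (a + 2) t i by
            rw [morseFun, if_neg (by omega), if_neg (by omega)],
          show morseFun a (true :: t) (i + 1) = morseFun (a + 2) t (i + 1) by
            rw [morseFun, if_neg (by omega), if_neg (by omega)]]
      · have := le_morseFun (μ := t) (show a + 2 ≤ a + 1 + 1 by omega)
        simp only [morseFun]
        rw [if_neg (by omega), if_neg (by omega), if_neg (by omega), if_pos trivial]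
        omega

lemma morseFun_lt_of_lt {n : ℕ} {μ : List Bool} (h : mLen μ = n) (i : Fin n) :
    morseFun 0 μ i < n := by
  have := morseFun_lt (a := 0) (μ := μ) (i := i) (by omega)
  omega

/-- The layered matching of `[n]` whose blocks are described by a Morse sequence of length
`n`. -/
def morsePerm {n : ℕ} (μ : List Bool) (h : mLen μ = n) : Equiv.Perm (Fin n) :=
  Function.Involutive.toPerm (fun i => ⟨morseFun 0 μ i, morseFun_lt_of_lt h i⟩)
    fun i => Fin.ext (morseFun_involutive 0 μ i)

lemma permVal_morsePerm {n : ℕ} {μ : List Bool} (h : mLen μ = n) {i : ℕ} (hi : i < n) :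
    permVal (morsePerm μ h) i = morseFun 0 μ i := by
  rw [permVal, dif_pos hi]
  rfl

lemma sum_descents_morsePerm {n : ℕ} {μ : List Bool} (h : mLen μ = n) (g : ℕ → ℕ) :
    (∑ i ∈ range (n - 1),
      if permVal (morsePerm μ h) (i + 1) < permVal (morsePerm μ h) i then g i else 0)
      = ∑ i ∈ Ico 0 (0 + mLen μ),
        if morseFun 0 μ (i + 1) < morseFun 0 μ i then g i else 0 := by
  rw [zero_add, h, ← range_eq_Ico]
  cases n with
  | zero => rfl
  | succ m =>
    rw [sum_range_succ, if_neg, add_zero]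
    · refine sum_congr rfl fun i hi => ?_
      have := mem_range.mp hi
      rw [permVal_morsePerm h (by omega), permVal_morsePerm h (by omega)]
    · have := morseFun_lt (a := 0) (μ := μ) (i := m) (by omega)
      rw [morseFun_of_ge (i := m + 1) (by omega)]
      omega

lemma majStat_morsePerm {n : ℕ} {μ : List Bool} (h : mLen μ = n) :
    majStat (morsePerm μ h) = morseW μ := by
  rw [majStat, sum_descents_morsePerm h fun i => i + 1]
  exact sum_descents_morseFun _ morseWAux (fun _ => rfl) (fun _ _ => rfl) (fun _ _ => rfl) 0 μ

lemma descStat_morsePerm {n : ℕ} {μ : List Bool} (h : mLen μ = n) :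
    descStat (morsePerm μ h) = μ.count true := by
  rw [descStat, card_filter, sum_descents_morsePerm h fun _ => 1]
  exact sum_descents_morseFun _ (fun _ μ => μ.count true) (by simp) (by simp)
    (by simp [add_comm]) 0 μ

lemma card_filter_perm_lt {n : ℕ} (σ : Equiv.Perm (Fin n)) (k : Fin n) :
    (univ.filter fun j => σ j < k).card = k := by
  have : (univ.filter fun j => σ j < k) = (Iio k).map σ.symm.toEmbedding := by
    ext j
    simp
  rw [this, card_map, Fin.card_Iio]

lemma permContains_of_lt {n : ℕ} {σ : Equiv.Perm (Fin n)} {π : Fin 3 → Fin 3} {i j k : Fin n}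
    (hij : i < j) (hjk : j < k)
    (h : ∀ a b : Fin 3, σ (![i, j, k] a) < σ (![i, j, k] b) ↔ π a < π b) : PermContains σ π := by
  refine ⟨![i, j, k], ?_, h⟩
  have := hij.trans hjk
  intro a b hab
  fin_cases a <;> fin_cases b <;> simp_all

lemma mem_S231_iff {n : ℕ} {σ : Equiv.Perm (Fin n)} :
    σ ∈ S231 n ↔ ∀ i, (σ i : ℕ) ≤ i + 1 ∧ (i : ℕ) ≤ σ i + 1 := by
  simp only [S231, mem_filter, mem_univ, true_and]
  constructor
  · rintro ⟨h231, h312, h321⟩ i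
    constructor
    · by_contra! hi
      have hsub : (univ.filter fun j => σ j < σ i) ⊆
          (univ.filter fun j => i < j ∧ σ j < σ i) ∪ Iio i := by
        intro j hj
        have hj := (mem_filter.mp hj).2
        rcases lt_trichotomy i j with h | rfl | h
        · simp [h, hj]
        · simp at hj
        · simp [h]
      have hcard := (card_le_card hsub).trans (card_union_le _ _)
      rw [card_filter_perm_lt, Fin.card_Iio] at hcard
      obtain ⟨j, k, hj, hk, hjk⟩ := one_lt_card_iff.mp
        (show 1 < (univ.filter fun j => i < j ∧ σ j < σ i).card by omega)
      wlog hlt : j < k generalizing j k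
      · exact this k j hk hj hjk.symm (lt_of_le_of_ne (not_lt.mp hlt) hjk.symm)
      have hj := (mem_filter.mp hj).2
      have hk := (mem_filter.mp hk).2
      rcases lt_or_gt_of_ne (σ.injective.ne hjk) with h | h
      · refine h312 (permContains_of_lt hj.1 hlt fun a b => ?_)
        fin_cases a <;> fin_cases b <;> simp [h, hj.2, hk.2, h.le, hj.2.le, hk.2.le]
      · refine h321 (permContains_of_lt hj.1 hlt fun a b => ?_)
        fin_cases a <;> fin_cases b <;> simp [h, hj.2, hk.2, h.le, hj.2.le, hk.2.le]
    · by_contra! hi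
      have hsub : Iio i ⊆ (univ.filter fun j => j < i ∧ σ i < σ j) ∪
          (univ.filter fun j => σ j < σ i) := by
        intro j hj
        have hj := mem_Iio.mp hj
        rcases lt_or_gt_of_ne (σ.injective.ne hj.ne) with h | h <;> simp [h, hj]
      have hcard := (card_le_card hsub).trans (card_union_le _ _)
      rw [card_filter_perm_lt, Fin.card_Iio] at hcard
      obtain ⟨j, k, hj, hk, hjk⟩ := one_lt_card_iff.mp
        (show 1 < (univ.filter fun j => j < i ∧ σ i < σ j).card by omega)
      wlog hlt : j < k generalizing j k
      · exact this k j hk hj hjk.symm (lt_of_le_of_ne (not_lt.mp hlt) hjk.symm)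
      have hj := (mem_filter.mp hj).2
      have hk := (mem_filter.mp hk).2
      rcases lt_or_gt_of_ne (σ.injective.ne hjk) with h | h
      · refine h231 (permContains_of_lt hlt hk.1 fun a b => ?_)
        fin_cases a <;> fin_cases b <;> simp [h, hj.2, hk.2, h.le, hj.2.le, hk.2.le]
      · refine h321 (permContains_of_lt hlt hk.1 fun a b => ?_)
        fin_cases a <;> fin_cases b <;> simp [h, hj.2, hk.2, h.le, hj.2.le, hk.2.le]
  · intro h
    have avoids : ∀ π : Fin 3 → Fin 3, π 2 < π 0 → PermAvoids σ π := by
      rintro π hπ ⟨f, hf, hfσ⟩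
      have h₁ : (f 0 : ℕ) < f 1 := hf 0 1 (by decide)
      have h₂ : (f 1 : ℕ) < f 2 := hf 1 2 (by decide)
      have h₃ : (σ (f 2) : ℕ) < σ (f 0) := (hfσ 2 0).mpr hπ
      have h₄ := h (f 0)
      have h₅ := h (f 2)
      omega
    exact ⟨avoids _ (by decide), avoids _ (by decide), avoids _ (by decide)⟩

lemma morsePerm_mem_S231 {n : ℕ} {μ : List Bool} (h : mLen μ = n) : morsePerm μ h ∈ S231 n :=
  mem_S231_iff.mpr fun i => morseFun_near 0 μ i

lemma exists_morseFun_eq {n : ℕ} {σ : Equiv.Perm (Fin n)}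
    (hσ : ∀ i, (σ i : ℕ) ≤ i + 1 ∧ (i : ℕ) ≤ σ i + 1) (k a : ℕ) (hk : a + k = n)
    (ha : ∀ i : Fin n, a ≤ i ↔ a ≤ σ i) :
    ∃ μ, mLen μ = k ∧ ∀ i : Fin n, a ≤ i → (σ i : ℕ) = morseFun a μ i := by
  induction k using Nat.strong_induction_on generalizing a with
  | _ k ih =>
    rcases k.eq_zero_or_pos with rfl | hpos
    · exact ⟨[], rfl, fun i hi => by omega⟩
    have hinj : ∀ i j : Fin n, (σ i : ℕ) = σ j → (i : ℕ) = j := fun i j h =>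
      congrArg Fin.val (σ.injective (Fin.ext h))
    set p : Fin n := ⟨a, by omega⟩ with hp
    have hpa : (p : ℕ) = a := rfl
    have hap := (ha p).mp le_rfl
    rcases (show (σ p : ℕ) = a ∨ (σ p : ℕ) = a + 1 by have := hσ p; omega) with h | h
    · obtain ⟨μ, hlen, hμ⟩ := ih (k - 1) (by omega) (a + 1) (by omega) fun i => by
        have h₁ := ha i
        have h₂ := hinj i p
        have h₄ : (i : ℕ) = a → (σ i : ℕ) = a := fun h' => by
          rwa [show i = p from Fin.ext h']
        omega
      refine ⟨false :: μ, by rw [mLen_false_cons]; omega, fun i hi => ?_⟩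
      rcases hi.eq_or_lt with hi | hi
      · obtain rfl : i = p := Fin.ext hi.symm
        simp only [morseFun]
        rw [morseFun_of_lt (by omega), h]
      · exact hμ i hi
    · have hr := (σ p).isLt
      set r : Fin n := ⟨a + 1, by omega⟩
      have hra : (r : ℕ) = a + 1 := rfl
      have hσr : (σ r : ℕ) = a := by
        have hs : (σ (σ.symm p) : ℕ) = a := by simp [hp]
        have h₁ := hσ (σ.symm p)
        have h₂ : ¬ (σ.symm p : ℕ) < a := by
          have := ha (σ.symm p)
          omega
        have h₃ : (σ.symm p : ℕ) ≠ a := fun h' => by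
          have : σ.symm p = p := Fin.ext h'
          rw [this] at hs
          omega
        have : σ.symm p = r := Fin.ext (by omega)
        rwa [← this]
      obtain ⟨μ, hlen, hμ⟩ := ih (k - 2) (by omega) (a + 2) (by omega) fun i => by
        have h₁ := ha i
        have h₂ := hinj i p
        have h₃ := hinj i r
        have h₄ : (i : ℕ) = a → (σ i : ℕ) = a + 1 := fun h' => by
          rwa [show i = p from Fin.ext h']
        have h₅ : (i : ℕ) = a + 1 → (σ i : ℕ) = a := fun h' => by
          rwa [show i = r from Fin.ext h']
        omega
      refine ⟨true :: μ, by rw [mLen_true_cons]; omega, fun i hi => ?_⟩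
      simp only [morseFun]
      split_ifs with h₁ h₂
      · obtain rfl : i = p := Fin.ext h₁
        exact h
      · obtain rfl : i = r := Fin.ext h₂
        exact hσr
      · exact hμ i (by omega)

/-- The bijection sending the letters of a Morse sequence to the blocks of a layered
matching. -/
noncomputable def morseEquiv (n : ℕ) : {μ // μ ∈ MSn n} ≃ {τ // τ ∈ S231 n} :=
  Equiv.ofBijective
    (fun μ => ⟨morsePerm μ.1 (mem_MSn.mp μ.2), morsePerm_mem_S231 (mem_MSn.mp μ.2)⟩) <| by
    constructor
    · rintro ⟨μ, hμ⟩ ⟨ν, hν⟩ h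
      have hμ' : mLen μ = n := mem_MSn.mp hμ
      have hν' : mLen ν = n := mem_MSn.mp hν
      refine Subtype.ext (morseFun_injective (a := 0) (hμ'.trans hν'.symm) fun i => ?_)
      rcases lt_or_ge i n with hi | hi
      · rw [← permVal_morsePerm hμ' hi, ← permVal_morsePerm hν' hi]
        exact congrArg (fun σ => permVal σ i) (congrArg Subtype.val h)
      · rw [morseFun_of_ge (by dsimp only; omega), morseFun_of_ge (by dsimp only; omega)]
    · rintro ⟨σ, hσ⟩
      obtain ⟨μ, hlen, hμ⟩ := exists_morseFun_eq (mem_S231_iff.mp hσ) n 0 (zero_add n)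
        fun _ => by simp
      exact ⟨⟨μ, mem_MSn.mpr hlen⟩, Subtype.ext (Equiv.ext fun i =>
        Fin.ext (hμ i (Nat.zero_le _)).symm)⟩

/-- `Σ_{τ ∈ Sₙ(231,312,321)} x^(s τ) y^(d τ) q^(maj τ) = Σ_{μ ∈ MSₙ} x^(t μ) y^(h μ) q^(w μ)`
in `ℤ[x,y,q]` (`t μ` = number of dots, `h μ` = number of dashes); moreover there is a
bijection `φ : MSₙ → Sₙ(231,312,321)` sending dots to singletons and dashes to doubletons,
so that `t μ = s (φ μ)`, `h μ = d (φ μ)` and `w μ = maj (φ μ)` for all `μ ∈ MSₙ`. -/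
theorem stmt8 (n : ℕ) :
    ((∑ τ ∈ S231 n, X 0 ^ (n - 2 * descStat τ) * X 1 ^ descStat τ * X 2 ^ majStat τ :
          MvPolynomial (Fin 3) ℤ)
      = ∑ μ ∈ MSn n, X 0 ^ μ.count false * X 1 ^ μ.count true * X 2 ^ morseW μ) ∧
    ∃ φ : {μ // μ ∈ MSn n} ≃ {τ // τ ∈ S231 n},
      ∀ μ : {μ // μ ∈ MSn n},
        μ.1.count false = n - 2 * descStat (φ μ).1 ∧
        μ.1.count true = descStat (φ μ).1 ∧
        morseW μ.1 = majStat (φ μ).1 := by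
  have key : ∀ μ : {μ // μ ∈ MSn n},
      μ.1.count false = n - 2 * descStat (morseEquiv n μ).1 ∧
      μ.1.count true = descStat (morseEquiv n μ).1 ∧
      morseW μ.1 = majStat (morseEquiv n μ).1 := by
    intro μ
    have hμ := mem_MSn.mp μ.2
    have hdesc : descStat (morseEquiv n μ).1 = μ.1.count true := descStat_morsePerm hμ
    have hmaj : majStat (morseEquiv n μ).1 = morseW μ.1 := majStat_morsePerm hμ
    have := mLen_eq_count μ.1
    exact ⟨by omega, hdesc.symm, hmaj.symm⟩
  refine ⟨?_, morseEquiv n, key⟩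
  rw [← sum_coe_sort (S231 n), ← sum_coe_sort (MSn n)]
  refine (Fintype.sum_equiv (morseEquiv n) _ _ fun μ => ?_).symm
  obtain ⟨h₁, h₂, h₃⟩ := key μ
  rw [h₁, h₂, h₃]
end

section
/- For every n ≥ 0, F_n^I(x,y,q) = Σ_{k : 2k ≤ n} C(n−k, k) x^{n−2k} y^k q^{C(n,2) − k}, as an identity in ℤ[x,y,q], where C(a,b) denotes the binomial coefficient and C(n,2) = n(n−1)/2. -/
open Finset MvPolynomial

open scoped Classical

/-- The set of ascents of `σ`. -/
def ascSet {n : ℕ} (σ : Equiv.Perm (Fin n)) : Finset ℕ :=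
  (range (n - 1)).filter fun i => permVal σ i < permVal σ (i + 1)

lemma mem_ascSet {n : ℕ} {σ : Equiv.Perm (Fin n)} {i : ℕ} :
    i ∈ ascSet σ ↔ i + 1 < n ∧ permVal σ i < permVal σ (i + 1) := by
  simp only [ascSet, mem_filter, mem_range]
  exact and_congr_left fun _ => by omega

lemma permVal_fin {n : ℕ} (σ : Equiv.Perm (Fin n)) (i : Fin n) : permVal σ i = σ i := by
  simp [permVal]

lemma permVal_inj {n : ℕ} (σ : Equiv.Perm (Fin n)) {i j : ℕ} (hi : i < n) (hj : j < n) :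
    permVal σ i = permVal σ j ↔ i = j := by
  simp [permVal, hi, hj, ← Fin.ext_iff]

/-- The number of pairs `i < j < n`. -/
lemma card_pairs_lt (n : ℕ) :
    ((range n ×ˢ range n).filter fun p => p.1 < p.2).card = n.choose 2 := by
  rw [Nat.choose_two_right, ← sum_range_id, card_filter, sum_product_right]
  refine sum_congr rfl fun j hj => ?_
  rw [← card_filter]
  have : (range n).filter (fun i => i < j) = range j := by
    ext i
    simp only [mem_filter, mem_range] at hj ⊢
    omega
  simp [this]

lemma invStat_eq {n : ℕ} {σ : Equiv.Perm (Fin n)} (hσ : σ ∈ S123 n) :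
    invStat σ = n.choose 2 - (ascSet σ).card := by
  rw [mem_S123_iff] at hσ
  suffices h : invStat σ + (ascSet σ).card = n.choose 2 by omega
  rw [← card_pairs_lt, invStat,
    ← card_image_of_injective (ascSet σ) (f := fun i => (i, i + 1))
      (fun a b h => (Prod.ext_iff.1 h).1), ← card_union_of_disjoint]
  · congr 1
    ext ⟨i, j⟩
    simp only [mem_union, mem_filter, mem_product, mem_range, mem_image, mem_ascSet,
      Prod.mk.injEq]
    constructor
    · rintro (h | ⟨a, h, rfl, rfl⟩)
      · exact ⟨h.1, h.2.1⟩
      · omega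
    · rintro ⟨⟨hi, hj⟩, hij⟩
      by_cases hinv : permVal σ j < permVal σ i
      · exact Or.inl ⟨⟨hi, hj⟩, hij, hinv⟩
      · have hne := mt (permVal_inj σ hi hj).1 hij.ne
        have hji : j = i + 1 := by
          by_contra hne'
          exact hinv (hσ i j (by omega) hj)
        subst hji
        exact Or.inr ⟨i, ⟨hj, by omega⟩, rfl, rfl⟩
  · rw [disjoint_left]
    rintro ⟨i, j⟩ h h'
    simp only [mem_filter, mem_image, mem_ascSet, Prod.mk.injEq] at h h'
    obtain ⟨a, h', rfl, rfl⟩ := h'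
    omega

/-- The sets `A` of naturals without two consecutive elements such that `i + 1 < n` for all
`i ∈ A`. -/
noncomputable def sparseSets (n : ℕ) : Finset (Finset ℕ) :=
  (range n).powerset.filter fun A => ∀ i ∈ A, i + 1 < n ∧ i + 1 ∉ A

lemma mem_sparseSets {n : ℕ} {A : Finset ℕ} :
    A ∈ sparseSets n ↔ ∀ i ∈ A, i + 1 < n ∧ i + 1 ∉ A := by
  simp only [sparseSets, mem_filter, mem_powerset, and_iff_right_iff_imp]
  intro h i hi
  have := (h i hi).1
  rw [mem_range]
  omega

lemma sparseSets_of_le_one {n : ℕ} (hn : n ≤ 1) : sparseSets n = {∅} := by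
  ext A
  rw [mem_sparseSets, mem_singleton, eq_empty_iff_forall_notMem]
  refine forall_congr' fun i => ⟨fun h hi => ?_, fun h hi => absurd hi h⟩
  have := (h hi).1
  omega

lemma notMem_of_mem_sparseSets {n m : ℕ} {A : Finset ℕ} (hA : A ∈ sparseSets n)
    (hm : n ≤ m + 1) : m ∉ A := fun h => by
  have := (mem_sparseSets.1 hA m h).1
  omega

lemma sparseSets_add_two (n : ℕ) :
    sparseSets (n + 2) = sparseSets (n + 1) ∪ (sparseSets n).image (insert n) := by
  ext A
  simp only [mem_union, mem_image]
  constructor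
  · intro hA
    rw [mem_sparseSets] at hA
    by_cases hn : n ∈ A
    · refine Or.inr ⟨A.erase n, mem_sparseSets.2 fun i hi => ?_, insert_erase hn⟩
      rw [mem_erase] at hi
      have h := hA i hi.2
      refine ⟨?_, fun h' => h.2 (mem_of_mem_erase h')⟩
      have : i + 1 ≠ n := fun e => h.2 (e ▸ hn)
      omega
    · refine Or.inl (mem_sparseSets.2 fun i hi => ⟨?_, (hA i hi).2⟩)
      have := (hA i hi).1
      have : i ≠ n := fun e => hn (e ▸ hi)
      omega
  · rintro (hA | ⟨B, hB, rfl⟩)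
    · rw [mem_sparseSets] at hA ⊢
      exact fun i hi => ⟨by have := (hA i hi).1; omega, (hA i hi).2⟩
    · have h1 := notMem_of_mem_sparseSets hB (m := n + 1) (by omega)
      rw [mem_sparseSets] at hB ⊢
      intro i hi
      rcases mem_insert.1 hi with rfl | hi
      · exact ⟨by omega, by simp [h1]⟩
      · have := hB i hi
        refine ⟨by omega, ?_⟩
        rw [mem_insert, not_or]
        exact ⟨by omega, this.2⟩

lemma card_sparseSets_filter (n k : ℕ) :
    ((sparseSets n).filter fun A => A.card = k).card = (n - k).choose k := by
  induction n using Nat.twoStepInduction generalizing k with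
  | zero => cases k <;> simp [sparseSets_of_le_one, filter_singleton]
  | one => cases k <;> simp [sparseSets_of_le_one, filter_singleton]
  | more n ih0 ih1 =>
    rw [sparseSets_add_two, filter_union, card_union_of_disjoint, ih1, filter_image]
    · cases k with
      | zero => simp
      | succ k =>
        have hfil : (sparseSets n).filter (fun A => (insert n A).card = k + 1) =
            (sparseSets n).filter fun A => A.card = k := filter_congr fun A hA => by
          rw [card_insert_of_notMem (notMem_of_mem_sparseSets hA (by omega))]
          omega
        rw [hfil, card_image_of_injOn, ih0]
        · rcases le_or_gt k n with h | h
          · rw [show n + 2 - (k + 1) = n - k + 1 by omega,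
              show n + 1 - (k + 1) = n - k by omega, Nat.choose_succ_succ, add_comm]
          · rw [Nat.choose_eq_zero_of_lt (by omega), Nat.choose_eq_zero_of_lt (by omega),
              Nat.choose_eq_zero_of_lt (by omega)]
        · intro A hA B hB h
          have hA' := notMem_of_mem_sparseSets (mem_filter.1 hA).1 (m := n) (by omega)
          have hB' := notMem_of_mem_sparseSets (mem_filter.1 hB).1 (m := n) (by omega)
          rw [← erase_insert hA', ← erase_insert hB']
          exact congrArg (fun C => C.erase n) h
    · refine disjoint_filter_filter (disjoint_left.2 fun A hA hA' => ?_)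
      obtain ⟨B, -, rfl⟩ := mem_image.1 hA'
      exact notMem_of_mem_sparseSets hA (m := n) le_rfl (mem_insert_self _ _)

lemma two_mul_card_le_of_mem_sparseSets {n : ℕ} {A : Finset ℕ} (hA : A ∈ sparseSets n) :
    2 * A.card ≤ n := by
  have hpos : 0 < ((sparseSets n).filter fun B => B.card = A.card).card :=
    card_pos.2 ⟨A, mem_filter.2 ⟨hA, rfl⟩⟩
  rw [card_sparseSets_filter] at hpos
  by_contra h
  rw [Nat.choose_eq_zero_of_lt (by omega)] at hpos
  omega

lemma ascSet_mem_sparseSets {n : ℕ} {σ : Equiv.Perm (Fin n)} (hσ : σ ∈ S123 n) :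
    ascSet σ ∈ sparseSets n := by
  rw [mem_S123_iff] at hσ
  refine mem_sparseSets.2 fun i hi => ⟨(mem_ascSet.1 hi).1, fun hi' => ?_⟩
  rw [mem_ascSet] at hi hi'
  have := hσ i (i + 2) le_rfl hi'.1
  have := hi'.2
  rw [show i + 1 + 1 = i + 2 from rfl] at this
  omega

lemma ascSet_injOn (n : ℕ) : Set.InjOn (ascSet (n := n)) (S123 n) := by
  intro σ hσ τ hτ h
  rw [mem_coe, mem_S123_iff] at hσ hτ
  have key : ∀ i j : Fin n, i < j → (σ i < σ j ↔ τ i < τ j) := by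
    intro i j hij
    rw [Fin.lt_def, Fin.lt_def, ← permVal_fin, ← permVal_fin, ← permVal_fin, ← permVal_fin]
    rcases Nat.lt_or_ge j (i + 2) with hj | hj
    · have e : (j : ℕ) = i + 1 := by
        have := Fin.lt_def.1 hij
        omega
      have hi : (i : ℕ) + 1 < n := e ▸ j.2
      have := Finset.ext_iff.1 h i
      simpa [mem_ascSet, hi, e] using this
    · have h1 := hσ i j hj j.2
      have h2 := hτ i j hj j.2
      omega
  have mono : StrictMono (σ * τ⁻¹) := by
    intro a b hab
    obtain ⟨i, rfl⟩ := τ.surjective a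
    obtain ⟨j, rfl⟩ := τ.surjective b
    simp only [Equiv.Perm.mul_apply, Equiv.Perm.inv_def, Equiv.symm_apply_apply]
    rcases lt_trichotomy i j with hij | rfl | hij
    · exact (key i j hij).2 hab
    · exact absurd hab (lt_irrefl _)
    · refine lt_of_le_of_ne (not_lt.1 fun h' => ?_) fun e => hij.ne' (σ.injective e)
      exact lt_asymm hab ((key j i hij).1 h')
  have hid : ⇑(σ * τ⁻¹) = id :=
    (mono.range_inj strictMono_id).1 (by rw [(σ * τ⁻¹).surjective.range_eq, Set.range_id])
  exact mul_inv_eq_one.1 (Equiv.ext fun i => congrFun hid i)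

/-- Exchange `i` and `i + 1` for each `i ∈ A`. -/
def swapAdjacent (A : Finset ℕ) (i : ℕ) : ℕ :=
  if i ∈ A then i + 1 else if i ≠ 0 ∧ i - 1 ∈ A then i - 1 else i

lemma swapAdjacent_lt {n : ℕ} {A : Finset ℕ} (hA : A ∈ sparseSets n) {i : ℕ} (hi : i < n) :
    swapAdjacent A i < n := by
  rw [mem_sparseSets] at hA
  unfold swapAdjacent
  split_ifs with h h'
  · exact (hA i h).1
  · omega
  · exact hi

lemma swapAdjacent_involutive {n : ℕ} {A : Finset ℕ} (hA : A ∈ sparseSets n) :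
    Function.Involutive (swapAdjacent A) := by
  rw [mem_sparseSets] at hA
  intro i
  by_cases h : i ∈ A
  · simp [swapAdjacent, h, (hA i h).2]
  · by_cases h' : i ≠ 0 ∧ i - 1 ∈ A
    · simp only [swapAdjacent, h, h', if_true, if_false, ne_eq, not_false_eq_true, and_self]
      omega
    · simp only [swapAdjacent, h, h', if_false]

/-- The reverse layered matching whose set of ascents is `A`. -/
def layeredPerm {n : ℕ} {A : Finset ℕ} (hA : A ∈ sparseSets n) : Equiv.Perm (Fin n) :=
  Fin.revPerm * Function.Involutive.toPerm
    (fun i : Fin n => (⟨swapAdjacent A i, swapAdjacent_lt hA i.2⟩ : Fin n))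
    (fun i => Fin.ext (swapAdjacent_involutive hA i))

lemma permVal_layeredPerm {n : ℕ} {A : Finset ℕ} (hA : A ∈ sparseSets n) {i : ℕ} (hi : i < n) :
    permVal (layeredPerm hA) i = n - (swapAdjacent A i + 1) := by
  simp only [permVal, hi, dite_true]
  rfl

lemma layeredPerm_mem_S123 {n : ℕ} {A : Finset ℕ} (hA : A ∈ sparseSets n) :
    layeredPerm hA ∈ S123 n := by
  rw [mem_S123_iff]
  intro i k hik hk
  rw [permVal_layeredPerm hA hk, permVal_layeredPerm hA (by omega)]
  have h1 := swapAdjacent_lt hA hk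
  suffices swapAdjacent A i < swapAdjacent A k by omega
  rw [mem_sparseSets] at hA
  unfold swapAdjacent
  split_ifs with h h₁ h₂
  · omega
  · have : k - 1 ≠ i + 1 := fun e => (hA i h).2 (e ▸ h₂.2)
    omega
  all_goals omega

lemma ascSet_layeredPerm {n : ℕ} {A : Finset ℕ} (hA : A ∈ sparseSets n) :
    ascSet (layeredPerm hA) = A := by
  ext i
  rw [mem_ascSet]
  by_cases hi : i + 1 < n
  · have h0 := swapAdjacent_lt hA hi
    have h1 := swapAdjacent_lt hA (i := i) (by omega)
    rw [permVal_layeredPerm hA hi, permVal_layeredPerm hA (by omega)]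
    by_cases h : i ∈ A
    · have e0 : swapAdjacent A i = i + 1 := by simp [swapAdjacent, h]
      have e1 : swapAdjacent A (i + 1) = i := by
        simp [swapAdjacent, h, (mem_sparseSets.1 hA i h).2]
      simp only [h, iff_true]
      omega
    · have e0 : swapAdjacent A i ≤ i := by
        unfold swapAdjacent
        split_ifs
        all_goals omega
      have e1 : i + 1 ≤ swapAdjacent A (i + 1) := by
        simp only [swapAdjacent, Nat.add_sub_cancel, h, and_false, if_false]
        split_ifs
        all_goals omega
      simp only [h, iff_false]
      omega
  · exact ⟨fun h => absurd h.1 hi, fun h => absurd (mem_sparseSets.1 hA i h).1 hi⟩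

/-- `Fₙᴵ(x,y,q) = Σ_{2k ≤ n} C(n-k, k) x^(n-2k) y^k q^(C(n,2) - k)` in `ℤ[x,y,q]`. -/
theorem stmt10 (n : ℕ) :
    FI n = ∑ k ∈ (Finset.range (n + 1)).filter fun k => 2 * k ≤ n,
      C (((n - k).choose k : ℕ) : ℤ) * X 0 ^ (n - 2 * k) * X 1 ^ k * X 2 ^ (n.choose 2 - k) := by
  have hbij : FI n = ∑ A ∈ sparseSets n,
      X 0 ^ (n - 2 * A.card) * X 1 ^ A.card * X 2 ^ (n.choose 2 - A.card) := by
    refine sum_nbij ascSet (fun σ => ascSet_mem_sparseSets) (ascSet_injOn n)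
      (fun A hA => ⟨layeredPerm hA, layeredPerm_mem_S123 hA, ascSet_layeredPerm hA⟩)
      fun σ hσ => ?_
    rw [invStat_eq hσ]
    rfl
  have hmaps : ∀ A ∈ sparseSets n,
      A.card ∈ (Finset.range (n + 1)).filter fun k => 2 * k ≤ n := fun A hA => by
    have := two_mul_card_le_of_mem_sparseSets hA
    rw [mem_filter, mem_range]
    omega
  rw [hbij, ← sum_fiberwise_of_maps_to hmaps]
  refine sum_congr rfl fun k _ => ?_
  rw [sum_congr rfl (g := fun _ => X 0 ^ (n - 2 * k) * X 1 ^ k * X 2 ^ (n.choose 2 - k))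
    fun A hA => by rw [(mem_filter.1 hA).2], sum_const, card_sparseSets_filter, nsmul_eq_mul]
  simp [mul_assoc]
end
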